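/- Let G be a simple graph and let H be a connected subgraph of G whose edge set is finite of cardinality k + 1 with k ≥ 1. Then there exists a connected subgraph H' of G with exactly k edges, a vertex v of H', and a vertex w with {v,w} an edge of G not belonging to H', such that H equals the subgraph obtained from H' by adding the vertex w and the edge {v,w}. -/

import Mathlib

theorem exists_frontier_edge {V : Type*} {G : SimpleGraph V} {H K : G.Subgraph}
    (hH : H.Connected) (hK : K.Connected) (hle : K ≤ H) (hne : K ≠ H) :
    ∃ v w, H.Adj v w ∧ v ∈ K.verts ∧ ¬ K.Adj v w := by
  by_cases hv : H.verts ⊆ K.verts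
  · by_contra hcon
    push Not at hcon
    apply hne
    refine le_antisymm hle ⟨hv, ?_⟩
    intro v w hvw
    exact hcon v w hvw (hv (H.edge_vert hvw))
  · obtain ⟨b, hbH, hbK⟩ := Set.not_subset.mp hv
    obtain ⟨a, haK⟩ := hK.nonempty
    obtain ⟨p⟩ := hH.preconnected.coe ⟨a, hle.1 haK⟩ ⟨b, hbH⟩
    obtain ⟨d, -, hd1, hd2⟩ := p.exists_boundary_dart {x | (x : V) ∈ K.verts} haK hbK
    refine ⟨d.fst, d.snd, d.adj, hd1, fun h => hd2 (K.edge_vert h.symm)⟩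

/-- Every connected subgraph `H` of `G` with `k + 1` edges (`k ≥ 1`)
is a one-edge expansion of some connected subgraph `H'` of `G` with exactly `k` edges:
there are a vertex `v` of `H'` and a vertex `w` with `{v,w}` an edge of `G` not in `H'`
such that `H = H' ⊔ subgraphOfAdj {v,w}`. -/
theorem exists_one_edge_expansion_predecessor {V : Type*} (G : SimpleGraph V)
    (H : G.Subgraph) (k : ℕ) (hk : 1 ≤ k) (hH : H.Connected)
    (hcard : H.edgeSet.ncard = k + 1) :
    ∃ (H' : G.Subgraph) (v w : V) (hadj : G.Adj v w),
      H'.Connected ∧ H'.edgeSet.ncard = k ∧ v ∈ H'.verts ∧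
      s(v, w) ∉ H'.edgeSet ∧ H = H' ⊔ G.subgraphOfAdj hadj := by
  have hfin : H.edgeSet.Finite := Set.finite_of_ncard_ne_zero (by omega)
  by_contra hcon
  have key : ∀ n : ℕ, ∃ K : G.Subgraph, K ≤ H ∧ K ≠ H ∧ K.Connected ∧ K.edgeSet.ncard = n := by
    intro n
    induction n with
    | zero =>
      obtain ⟨a, ha⟩ := hH.nonempty
      refine ⟨G.singletonSubgraph a, by simpa using ha, ?_,
        SimpleGraph.Subgraph.singletonSubgraph_connected, by simp⟩
      rintro rfl
      simp at hcard
    | succ n ih =>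
      obtain ⟨K, hle, hne, hK, hn⟩ := ih
      obtain ⟨v, w, hvw, hv, hnot⟩ := exists_frontier_edge hH hK hle hne
      have hKE : K.edgeSet.Finite := hfin.subset (SimpleGraph.Subgraph.edgeSet_mono hle)
      have hnm : s(v, w) ∉ K.edgeSet := by simpa using hnot
      have hcd : (K ⊔ G.subgraphOfAdj hvw.adj_sub).edgeSet.ncard = n + 1 := by
        rw [SimpleGraph.Subgraph.edgeSet_sup, SimpleGraph.edgeSet_subgraphOfAdj,
          Set.union_singleton, Set.ncard_insert_of_notMem hnm hKE, hn]
      refine ⟨K ⊔ G.subgraphOfAdj hvw.adj_sub,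
        sup_le hle (SimpleGraph.subgraphOfAdj_le_of_adj H hvw), ?_, ?_, hcd⟩
      · intro heq
        refine hcon ⟨K, v, w, hvw.adj_sub, hK, ?_, hv, hnm, heq.symm⟩
        rw [heq] at hcd
        omega
      · exact SimpleGraph.Subgraph.connected_sup hK.preconnected
          (SimpleGraph.Subgraph.subgraphOfAdj_connected _).preconnected ⟨v, hv, by simp⟩
  obtain ⟨K, hle, -, -, hn⟩ := key (k + 2)
  have := Set.ncard_le_ncard (SimpleGraph.Subgraph.edgeSet_mono hle) hfin
  omega
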